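/- Assume n_1 = … = n_m > 2. Suppose 1 < α < n·/2 and (m+1)/m ≤ a_1 = … = a_m < n_1/2, and that (2/3)·(n·/2 − α)·(α − 1) ≥ (3/2)·(m − 1)·(n·/2 − a·) and ((n·/2 − α)·(n·/2 − 1))/3 ≥ ((m − 1)·(n·/2 − a·))/2. Then for every parameter λ (all λ_{i,j} > 0), R^KL(λ̂^{(α;a)}(X,Y,Z), λ) < R^KL(λ̂^J(X,Y,Z), λ); that is, under the entropy loss, when the additional top-level observation Z is used, the stick-breaking Bayes estimator strictly dominates the Jeffreys-prior Bayes estimator. -/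

import Mathlib

open scoped BigOperators ENNReal

/-- The Poisson(μ) probability of the value `k`. -/
noncomputable def poissonPmf (mu : ℝ) (k : ℕ) : ℝ :=
  mu ^ k * Real.exp (-mu) / (Nat.factorial k)

/-- Joint pmf of the multi-group observations: the X_{i,j} ~ Po(λ_{i,j}) and the
Y_i ~ Po(λ_{i·}) are all independent. -/
noncomputable def jointPmf2 (m : ℕ) (n : Fin m → ℕ) (lam : (i : Fin m) → Fin (n i) → ℝ)
    (x : (i : Fin m) → Fin (n i) → ℕ) (y : Fin m → ℕ) : ℝ :=
  ∏ i, (poissonPmf (∑ j, lam i j) (y i) * ∏ j, poissonPmf (lam i j) (x i j))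

/-- Joint pmf of (X, Y, Z), where additionally Z ~ Po(Λ), Λ = Σ_i λ_{i·},
independent of everything else. -/
noncomputable def jointPmf3 (m : ℕ) (n : Fin m → ℕ) (lam : (i : Fin m) → Fin (n i) → ℝ)
    (x : (i : Fin m) → Fin (n i) → ℕ) (y : Fin m → ℕ) (z : ℕ) : ℝ :=
  poissonPmf (∑ i, ∑ j, lam i j) z * jointPmf2 m n lam x y

/-- Entropy (Kullback–Leibler) loss of an estimate d of λ. -/
noncomputable def lossKL (m : ℕ) (n : Fin m → ℕ) (d : (i : Fin m) → Fin (n i) → ℝ)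
    (lam : (i : Fin m) → Fin (n i) → ℝ) : ℝ :=
  ∑ i, ∑ j, (d i j - lam i j - lam i j * Real.log (d i j / lam i j))

/-- Entropy risk of an estimator based on (X, Y, Z), valued in [0,∞]. -/
noncomputable def riskKL3 (m : ℕ) (n : Fin m → ℕ)
    (δ : ((i : Fin m) → Fin (n i) → ℕ) → (Fin m → ℕ) → ℕ → (i : Fin m) → Fin (n i) → ℝ)
    (lam : (i : Fin m) → Fin (n i) → ℝ) : ℝ≥0∞ :=
  ∑' x : (i : Fin m) → Fin (n i) → ℕ, ∑' y : Fin m → ℕ, ∑' z : ℕ,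
    ENNReal.ofReal (lossKL m n (δ x y z) lam * jointPmf3 m n lam x y z)

/-- The stick-breaking Bayes estimator using Z: λ̂^{(α;a)}_{i,j}(X,Y,Z) =
((X··+Y·+Z+α)/3)·((X_{i·}+Y_i+a_i)/(X··+Y·+a·))·((X_{i,j}+1/2)/(X_{i·}+n_i/2)). -/
noncomputable def estAA3 (m : ℕ) (n : Fin m → ℕ) (α : ℝ) (a : Fin m → ℝ)
    (x : (i : Fin m) → Fin (n i) → ℕ) (y : Fin m → ℕ) (z : ℕ) (i : Fin m) (j : Fin (n i)) : ℝ :=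
  ((∑ k, ∑ l, (x k l : ℝ)) + (∑ k, (y k : ℝ)) + (z : ℝ) + α) / 3 *
    (((∑ k, (x i k : ℝ)) + (y i : ℝ) + a i) /
      ((∑ k, ∑ l, (x k l : ℝ)) + (∑ k, (y k : ℝ)) + ∑ k, a k)) *
    (((x i j : ℝ) + 1 / 2) / ((∑ k, (x i k : ℝ)) + (n i : ℝ) / 2))

open MeasureTheory ProbabilityTheory NNReal

section PartialCount

variable {ι κ : Type*} [Fintype κ]

/-- A partial sum of the counts. -/
def partialCount (e : κ → ι) (ω : ι → ℕ) : ℝ := ∑ k, (ω (e k) : ℝ)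

lemma partialCount_eq (e : κ → ι) (ω : ι → ℕ) :
    partialCount e ω = ((∑ k, ω (e k) : ℕ) : ℝ) := by
  simp [partialCount]

lemma partialCount_nonneg (e : κ → ι) (ω : ι → ℕ) : 0 ≤ partialCount e ω := by
  rw [partialCount_eq]; positivity

lemma ofReal_partialCount_mul (e : κ → ι) (f : ℝ → ℝ) (ω : ι → ℕ) :
    ENNReal.ofReal (partialCount e ω * f (partialCount e ω - 1)) =
      ((∑ k, ω (e k) : ℕ) : ℝ≥0∞) *
        ENNReal.ofReal (f (((∑ k, ω (e k) - 1 : ℕ) : ℕ) : ℝ)) := by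
  rw [partialCount_eq, ENNReal.ofReal_mul (by positivity), ENNReal.ofReal_natCast]
  rcases Nat.eq_zero_or_pos (∑ k, ω (e k)) with h | h
  · simp [h]
  · rw [Nat.cast_pred h]

lemma partialCount_mul_nonneg (e : κ → ι) {f : ℝ → ℝ} (hf : ∀ x, 0 ≤ x → 0 ≤ f x)
    (ω : ι → ℕ) : 0 ≤ partialCount e ω * f (partialCount e ω - 1) := by
  rw [partialCount_eq]
  rcases Nat.eq_zero_or_pos (∑ k, ω (e k)) with h | h
  · simp [h]
  · refine mul_nonneg (by positivity) (hf _ ?_)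
    rw [← Nat.cast_pred h]; positivity

end PartialCount

/-- The joint law of independent Poisson counts with rates `θ`. -/
noncomputable def poissonPi {ι : Type*} [Fintype ι] (θ : ι → ℝ≥0) : Measure (ι → ℕ) :=
  Measure.pi fun c => poissonMeasure (θ c)

section PoissonPi

variable {ι κ : Type*} [Fintype ι] [Fintype κ] (θ : ι → ℝ≥0)

instance : IsProbabilityMeasure (poissonPi θ) := by
  unfold poissonPi; infer_instance

lemma poissonPi_singleton (ω : ι → ℕ) :
    poissonPi θ {ω} = ∏ c, poissonMeasure (θ c) {ω c} := by
  simp [poissonPi]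

lemma poissonMeasure_singleton_succ (r : ℝ≥0) (k : ℕ) :
    ((k + 1 : ℕ) : ℝ≥0∞) * poissonMeasure r {k + 1} = r * poissonMeasure r {k} := by
  rw [poissonMeasure_singleton, poissonMeasure_singleton, ← ENNReal.ofReal_natCast,
    ← ENNReal.ofReal_coe_nnreal, ← ENNReal.ofReal_mul (by positivity),
    ← ENNReal.ofReal_mul (by positivity)]
  congr 1
  rw [Nat.factorial_succ]
  push_cast
  field_simp
  ring

lemma mul_poissonPi_singleton_add_single [DecidableEq ι] (c : ι) (ω : ι → ℕ) :
    ((ω c + 1 : ℕ) : ℝ≥0∞) * poissonPi θ {ω + Pi.single c 1} =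
      θ c * poissonPi θ {ω} := by
  rw [poissonPi_singleton, poissonPi_singleton,
    ← Finset.mul_prod_erase _ _ (Finset.mem_univ c), ← mul_assoc,
    ← Finset.mul_prod_erase _ (fun i => poissonMeasure (θ i) {ω i}) (Finset.mem_univ c),
    ← mul_assoc]
  congr 1
  · simpa using poissonMeasure_singleton_succ (θ c) (ω c)
  · refine Finset.prod_congr rfl fun i hi => ?_
    simp [Pi.single_eq_of_ne (Finset.ne_of_mem_erase hi)]

/-- The Poisson Stein identity in one coordinate. -/
lemma lintegral_coord_mul_poissonPi [DecidableEq ι] (c : ι) (F : (ι → ℕ) → ℝ≥0∞) :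
    ∫⁻ ω, (ω c : ℝ≥0∞) * F ω ∂poissonPi θ =
      θ c * ∫⁻ ω, F (ω + Pi.single c 1) ∂poissonPi θ := by
  have hinj : Function.Injective fun ω : ι → ℕ => ω + Pi.single c 1 :=
    add_left_injective _
  rw [lintegral_countable', lintegral_countable', ← ENNReal.tsum_mul_left, ← hinj.tsum_eq]
  · refine tsum_congr fun ω => ?_
    calc _ = F (ω + Pi.single c 1) * (((ω c + 1 : ℕ) : ℝ≥0∞) *
          poissonPi θ {ω + Pi.single c 1}) := by simp; ring
      _ = _ := by rw [mul_poissonPi_singleton_add_single]; ring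
  · intro ω hω
    have h0 : ω c ≠ 0 := by
      rintro h
      simp [h] at hω
    refine ⟨ω - Pi.single c 1, ?_⟩
    ext i
    by_cases hi : i = c
    · subst hi; simp; omega
    · simp [Pi.single_eq_of_ne hi]

/-- The Poisson Stein identity for a partial sum of the counts. -/
lemma lintegral_sum_mul_poissonPi {e : κ → ι} (he : Function.Injective e) (f : ℕ → ℝ≥0∞) :
    ∫⁻ ω, ((∑ k, ω (e k) : ℕ) : ℝ≥0∞) * f (∑ k, ω (e k) - 1) ∂poissonPi θ =
      (∑ k, θ (e k) : ℝ≥0) * ∫⁻ ω, f (∑ k, ω (e k)) ∂poissonPi θ := by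
  classical
  push_cast
  simp_rw [Finset.sum_mul]
  rw [lintegral_finsetSum _ fun _ _ => Measurable.of_discrete]
  refine Finset.sum_congr rfl fun k _ => ?_
  rw [lintegral_coord_mul_poissonPi θ (e k) fun ω => f (∑ k, ω (e k) - 1)]
  congr 2
  ext ω
  simp [Finset.sum_add_distrib, Pi.single_apply, he.eq_iff]

lemma integrable_of_bound_poissonPi {f : (ι → ℕ) → ℝ} {B : ℝ} (h : ∀ ω, |f ω| ≤ B) :
    Integrable f (poissonPi θ) :=
  Integrable.of_bound Measurable.of_discrete.aestronglyMeasurable B (.of_forall h)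

lemma integrable_partialCount_mul {e : κ → ι} (he : Function.Injective e) {f : ℝ → ℝ} {B : ℝ}
    (hf : ∀ x, 0 ≤ x → 0 ≤ f x) (hB : ∀ x, 0 ≤ x → f x ≤ B) :
    Integrable (fun ω => partialCount e ω * f (partialCount e ω - 1)) (poissonPi θ) := by
  refine ⟨Measurable.of_discrete.aestronglyMeasurable, ?_⟩
  rw [hasFiniteIntegral_iff_ofReal (.of_forall (partialCount_mul_nonneg e hf))]
  simp_rw [ofReal_partialCount_mul]
  rw [lintegral_sum_mul_poissonPi θ he fun k => ENNReal.ofReal (f k)]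
  refine ENNReal.mul_lt_top ENNReal.coe_lt_top ?_
  refine lt_of_le_of_lt (lintegral_mono (g := fun _ => ENNReal.ofReal B) fun ω =>
    ENNReal.ofReal_le_ofReal (hB _ (by positivity))) ?_
  simp

/-- The Poisson Stein identity `E[N f(N - 1)] = θ E[f(N)]` for a partial sum `N` of the counts
with total rate `θ`. -/
lemma integral_partialCount_mul {e : κ → ι} (he : Function.Injective e) {f : ℝ → ℝ}
    (hf : ∀ x, 0 ≤ x → 0 ≤ f x) :
    ∫ ω, partialCount e ω * f (partialCount e ω - 1) ∂poissonPi θ =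
      (∑ k, (θ (e k) : ℝ)) * ∫ ω, f (partialCount e ω) ∂poissonPi θ := by
  rw [integral_eq_lintegral_of_nonneg_ae (.of_forall (partialCount_mul_nonneg e hf))
      Measurable.of_discrete.aestronglyMeasurable,
    integral_eq_lintegral_of_nonneg_ae (.of_forall fun ω => hf _ (partialCount_nonneg e ω))
      Measurable.of_discrete.aestronglyMeasurable]
  simp_rw [ofReal_partialCount_mul]
  rw [lintegral_sum_mul_poissonPi θ he fun k => ENNReal.ofReal (f k), ENNReal.toReal_mul,
    ENNReal.coe_toReal, NNReal.coe_sum]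
  simp only [partialCount_eq]

lemma integrable_partialCount {e : κ → ι} (he : Function.Injective e) :
    Integrable (partialCount e) (poissonPi θ) := by
  simpa using integrable_partialCount_mul θ he (f := fun _ => 1) (B := 1) (by simp) (by simp)

lemma integrable_log_partialCount_add {e : κ → ι} (he : Function.Injective e) {c : ℝ}
    (hc : 0 < c) : Integrable (fun ω => Real.log (partialCount e ω + c)) (poissonPi θ) := by
  refine ((integrable_partialCount θ he).add (integrable_const (c + c⁻¹))).mono'
    Measurable.of_discrete.aestronglyMeasurable (.of_forall fun ω => ?_)
  have h0 := partialCount_nonneg e ω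
  have h1 : 0 < partialCount e ω + c := by positivity
  have h2 : (partialCount e ω + c)⁻¹ ≤ c⁻¹ := inv_anti₀ hc (by linarith)
  have h3 := Real.log_le_sub_one_of_pos h1
  have h4 := Real.log_le_sub_one_of_pos (inv_pos.2 h1)
  rw [Real.log_inv] at h4
  have h5 : 0 < c⁻¹ := inv_pos.2 hc
  simp only [Real.norm_eq_abs, abs_le, Pi.add_apply]
  constructor <;> linarith

/-- `E[1 / (N + c)] ≤ 1 / (θ + c - 1)` for a Poisson count `N` with rate `θ` and `c > 1`. -/
lemma integral_inv_partialCount_add_le {e : κ → ι} (he : Function.Injective e) {c : ℝ}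
    (hc : 1 < c) :
    ∫ ω, (partialCount e ω + c)⁻¹ ∂poissonPi θ ≤ (∑ k, (θ (e k) : ℝ) + c - 1)⁻¹ := by
  have hθ : 0 ≤ ∑ k, (θ (e k) : ℝ) := Finset.sum_nonneg fun _ _ => NNReal.coe_nonneg _
  have hst := integral_partialCount_mul θ he (f := fun x => (x + c)⁻¹)
    fun x hx => by have : 0 < x + c := by linarith
                   positivity
  have hint : ∀ d : ℝ, 0 < d →
      Integrable (fun ω => (partialCount e ω + d)⁻¹) (poissonPi θ) := fun d hd => by
    refine integrable_of_bound_poissonPi θ (B := d⁻¹) fun ω => ?_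
    have h0 := partialCount_nonneg e ω
    rw [abs_of_nonneg (by positivity)]
    exact inv_anti₀ hd (by linarith)
  have hpt : ∀ ω, partialCount e ω * (partialCount e ω - 1 + c)⁻¹ ≤
      1 - (c - 1) * (partialCount e ω + c)⁻¹ := fun ω => by
    have h0 := partialCount_nonneg e ω
    have h1 : 0 < partialCount e ω - 1 + c := by linarith
    have h2 : (partialCount e ω + c)⁻¹ ≤ (partialCount e ω - 1 + c)⁻¹ :=
      inv_anti₀ h1 (by linarith)
    have h3 : partialCount e ω * (partialCount e ω - 1 + c)⁻¹ =
        1 - (c - 1) * (partialCount e ω - 1 + c)⁻¹ := by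
      field_simp; ring
    nlinarith
  have hle := integral_mono (μ := poissonPi θ)
    (integrable_partialCount_mul θ he (f := fun x => (x + c)⁻¹) (B := c⁻¹)
      (fun x hx => by positivity) fun x hx => inv_anti₀ (by linarith) (by linarith))
    ((integrable_const 1).sub ((hint c (by linarith)).const_mul (c - 1))) hpt
  simp only [Pi.sub_apply] at hle
  rw [hst, integral_sub (integrable_const _) ((hint c (by linarith)).const_mul _),
    integral_const_mul] at hle
  simp only [integral_const, probReal_univ, smul_eq_mul, mul_one] at hle
  rw [← one_div, le_div_iff₀ (by linarith)]
  linarith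

end PoissonPi

section LogInequalities

/-- A tangent-line bound for the concave function `v ↦ v * log ((v + p) / (v + q))`. -/
lemma mul_log_sub_log_le_tangent {p q u v : ℝ} (hq : 0 < q) (hqp : q ≤ p) (hu : 0 ≤ u)
    (hv : 0 ≤ v) :
    v * (Real.log (v + p) - Real.log (v + q)) ≤
      v * (Real.log (u + p) - Real.log (u + q)) +
        (p - q) * u / ((u + q) * (u + p)) * (u - v) := by
  have hvp : 0 < v + p := by linarith
  have hvq : 0 < v + q := by linarith
  have hup : 0 < u + p := by linarith
  have huq : 0 < u + q := by linarith
  have hlog : Real.log (v + p) - Real.log (v + q) - (Real.log (u + p) - Real.log (u + q)) ≤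
      (p - q) * (u - v) / ((v + q) * (u + p)) := by
    have h := Real.log_le_sub_one_of_pos
      (show 0 < (v + p) * (u + q) / ((v + q) * (u + p)) by positivity)
    rw [Real.log_div (by positivity) (by positivity), Real.log_mul (by positivity) (by positivity),
      Real.log_mul (by positivity) (by positivity)] at h
    have h2 : (v + p) * (u + q) / ((v + q) * (u + p)) - 1 =
        (p - q) * (u - v) / ((v + q) * (u + p)) := by
      field_simp; ring
    linarith
  have hcmp : v * ((p - q) * (u - v) / ((v + q) * (u + p))) ≤
      (p - q) * u / ((u + q) * (u + p)) * (u - v) := by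
    have h3 : (p - q) * u / ((u + q) * (u + p)) * (u - v) -
        v * ((p - q) * (u - v) / ((v + q) * (u + p))) =
        (p - q) * q * (u - v) ^ 2 / ((v + q) * (u + q) * (u + p)) := by
      field_simp; ring
    have h4 : 0 ≤ (p - q) * q * (u - v) ^ 2 / ((v + q) * (u + q) * (u + p)) := by
      have := sub_nonneg.2 hqp
      positivity
    linarith
  have := mul_le_mul_of_nonneg_left hlog hv
  linarith

lemma sum_mul_log_sub_log_le {m : ℕ} (hm : 1 ≤ m) {p q : ℝ} (hq : 0 < q) (hqp : q ≤ p)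
    {v : Fin m → ℝ} (hv : ∀ i, 0 ≤ v i) :
    ∑ i, v i * (Real.log (v i + p) - Real.log (v i + q)) ≤
      (∑ i, v i) * (Real.log (∑ i, v i + m * p) - Real.log (∑ i, v i + m * q)) := by
  have hm0 : (0 : ℝ) < m := by exact_mod_cast hm
  set s := ∑ i, v i with hs
  have hs0 : 0 ≤ s := Finset.sum_nonneg fun i _ => hv i
  have h := Finset.sum_le_sum fun i (_ : i ∈ Finset.univ) =>
    mul_log_sub_log_le_tangent hq hqp (show 0 ≤ s / m by positivity) (hv i)
  refine h.trans (le_of_eq ?_)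
  rw [Finset.sum_add_distrib, ← Finset.sum_mul, ← Finset.mul_sum, Finset.sum_sub_distrib, ← hs]
  have h1 : s / m + p = (s + m * p) / m := by field_simp
  have h2 : s / m + q = (s + m * q) / m := by field_simp
  have h3 : 0 < s + m * q := by positivity
  have h4 : 0 < s + m * p := by have := hq.trans_le hqp; positivity
  have h5 : ∑ _i : Fin m, s / m = s := by simp; field_simp
  rw [h5, sub_self, mul_zero, add_zero, h1, h2, Real.log_div h4.ne' hm0.ne',
    Real.log_div h3.ne' hm0.ne']
  ring

lemma sum_mul_log_sub_mul_log_le {m : ℕ} (hm : 1 ≤ m) {a b : ℝ} (ha : (m : ℝ) + 1 ≤ m * a)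
    (hab : a ≤ b) {v : Fin m → ℝ} (hv : ∀ i, 0 ≤ v i) :
    ∑ i, v i * (Real.log (v i - 1 + b) - Real.log (v i - 1 + a)) -
        (∑ i, v i) * (Real.log (∑ i, v i - 1 + m * b) - Real.log (∑ i, v i - 1 + m * a)) ≤
      (m - 1) * (m * b - m * a) * (∑ i, v i + m * b)⁻¹ := by
  have hm1 : (1 : ℝ) ≤ m := by exact_mod_cast hm
  have ha1 : 1 < a := by nlinarith
  have hsum := sum_mul_log_sub_log_le hm (sub_pos.2 ha1) (sub_le_sub_right hab 1) hv
  set s := ∑ i, v i with hs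
  have hs0 : 0 ≤ s := Finset.sum_nonneg fun i _ => hv i
  have hmab : (m : ℝ) * a ≤ m * b := by gcongr
  have e1 : ∀ x y : ℝ, x + (y - 1) = x - 1 + y := fun x y => by ring
  simp only [e1] at hsum
  set A : ℝ := m * a
  set N : ℝ := m * b
  have e2 : s + m * (b - 1) = s + (N - m) := by simp only [N]; ring
  have e3 : s + m * (a - 1) = s + (A - m) := by simp only [A]; ring
  rw [e2, e3] at hsum
  have p1 : 0 < s + (N - m) := by linarith
  have p2 : 0 < s + (A - m) := by linarith
  have p3 : 0 < s - 1 + N := by linarith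
  have p4 : 0 < s - 1 + A := by linarith
  have h := Real.log_le_sub_one_of_pos
    (show 0 < (s + (N - m)) * (s - 1 + A) / ((s + (A - m)) * (s - 1 + N)) by positivity)
  rw [Real.log_div (by positivity) (by positivity), Real.log_mul (by positivity) (by positivity),
    Real.log_mul (by positivity) (by positivity)] at h
  have h2 : (s + (N - m)) * (s - 1 + A) / ((s + (A - m)) * (s - 1 + N)) - 1 =
      (m - 1) * (N - A) / ((s + (A - m)) * (s - 1 + N)) := by
    field_simp; ring
  have h3 : s * ((m - 1) * (N - A) / ((s + (A - m)) * (s - 1 + N))) ≤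
      (m - 1) * (N - A) * (s + N)⁻¹ := by
    have hD : 0 ≤ ((m : ℝ) - 1) * (N - A) := mul_nonneg (by linarith) (by linarith)
    rw [mul_div_left_comm, ← div_eq_mul_inv]
    rw [← mul_div_assoc, div_le_div_iff₀ (by positivity) (by linarith)]
    have : s * (s + N) ≤ (s + (A - m)) * (s - 1 + N) := by nlinarith
    nlinarith
  have h4 := mul_le_mul_of_nonneg_left h hs0
  rw [h2] at h4
  linarith

end LogInequalities

section Transfer

variable {m : ℕ} {n : Fin m → ℕ}

/-- Index set of all the counts `X i j`, `Y i`, `Z`. -/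
abbrev CountIdx (m : ℕ) (n : Fin m → ℕ) : Type := ((Σ i, Fin (n i)) ⊕ Fin m) ⊕ Unit

/-- The rates of all the counts. -/
noncomputable def countRate (lam : (i : Fin m) → Fin (n i) → ℝ) : CountIdx m n → ℝ≥0 :=
  Sum.elim (Sum.elim (fun c => (lam c.1 c.2).toNNReal) fun i => (∑ j, lam i j).toNNReal)
    fun _ => (∑ i, ∑ j, lam i j).toNNReal

/-- A family of counts split into `((X, Y), Z)`. -/
def splitCounts (m : ℕ) (n : Fin m → ℕ) :
    (CountIdx m n → ℕ) ≃ (((i : Fin m) → Fin (n i) → ℕ) × (Fin m → ℕ)) × ℕ :=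
  (Equiv.sumArrowEquivProdArrow _ _ _).trans (Equiv.prodCongr
    ((Equiv.sumArrowEquivProdArrow _ _ _).trans
      (Equiv.prodCongr (Equiv.piCurry fun _ _ => ℕ) (Equiv.refl _)))
    (Equiv.funUnique Unit ℕ))

lemma poissonPmf_nonneg {mu : ℝ} (hmu : 0 ≤ mu) (k : ℕ) : 0 ≤ poissonPmf mu k := by
  unfold poissonPmf; positivity

lemma ofReal_poissonPmf {mu : ℝ} (hmu : 0 ≤ mu) (k : ℕ) :
    ENNReal.ofReal (poissonPmf mu k) = poissonMeasure mu.toNNReal {k} := by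
  rw [poissonMeasure_singleton, Real.coe_toNNReal _ hmu, poissonPmf, mul_comm]

lemma jointPmf3_nonneg {lam : (i : Fin m) → Fin (n i) → ℝ} (hlam : ∀ i j, 0 ≤ lam i j)
    (x : (i : Fin m) → Fin (n i) → ℕ) (y : Fin m → ℕ) (z : ℕ) :
    0 ≤ jointPmf3 m n lam x y z := by
  have h1 : ∀ i, 0 ≤ ∑ j, lam i j := fun i => Finset.sum_nonneg fun j _ => hlam i j
  exact mul_nonneg (poissonPmf_nonneg (Finset.sum_nonneg fun i _ => h1 i) _)
    (Finset.prod_nonneg fun i _ => mul_nonneg (poissonPmf_nonneg (h1 i) _)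
      (Finset.prod_nonneg fun j _ => poissonPmf_nonneg (hlam i j) _))

lemma ofReal_jointPmf3 {lam : (i : Fin m) → Fin (n i) → ℝ} (hlam : ∀ i j, 0 ≤ lam i j)
    (ω : CountIdx m n → ℕ) :
    ENNReal.ofReal (jointPmf3 m n lam (fun i j => ω (.inl (.inl ⟨i, j⟩)))
      (fun i => ω (.inl (.inr i))) (ω (.inr ()))) = poissonPi (countRate lam) {ω} := by
  have h1 : ∀ i, 0 ≤ ∑ j, lam i j := fun i => Finset.sum_nonneg fun j _ => hlam i j
  have h2 : 0 ≤ ∑ i, ∑ j, lam i j := Finset.sum_nonneg fun i _ => h1 i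
  have h3 : ∀ i, 0 ≤ ∏ j, poissonPmf (lam i j) (ω (.inl (.inl ⟨i, j⟩))) := fun i =>
    Finset.prod_nonneg fun j _ => poissonPmf_nonneg (hlam i j) _
  rw [poissonPi_singleton, jointPmf3, jointPmf2, ENNReal.ofReal_mul (poissonPmf_nonneg h2 _),
    ENNReal.ofReal_prod_of_nonneg fun i _ => mul_nonneg (poissonPmf_nonneg (h1 i) _) (h3 i),
    Fintype.prod_sum_type, Fintype.prod_sum_type, Fintype.prod_sigma, mul_comm,
    ← Finset.prod_mul_distrib,
    Fintype.prod_unique fun c : Unit => poissonMeasure (countRate lam (.inr c)) {ω (.inr c)},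
    ofReal_poissonPmf h2]
  congr 1
  refine Finset.prod_congr rfl fun i _ => ?_
  rw [ENNReal.ofReal_mul (poissonPmf_nonneg (h1 i) _), ofReal_poissonPmf (h1 i),
    ENNReal.ofReal_prod_of_nonneg fun j _ => poissonPmf_nonneg (hlam i j) _, mul_comm]
  congr 1
  exact Finset.prod_congr rfl fun j _ => ofReal_poissonPmf (hlam i j) _

/-- The entropy risk is an integral against the joint law of the counts. -/
lemma riskKL3_eq_lintegral {lam : (i : Fin m) → Fin (n i) → ℝ} (hlam : ∀ i j, 0 ≤ lam i j)
    (δ : ((i : Fin m) → Fin (n i) → ℕ) → (Fin m → ℕ) → ℕ → (i : Fin m) → Fin (n i) → ℝ) :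
    riskKL3 m n δ lam = ∫⁻ ω, ENNReal.ofReal (lossKL m n
      (δ (fun i j => ω (.inl (.inl ⟨i, j⟩))) (fun i => ω (.inl (.inr i))) (ω (.inr ()))) lam)
      ∂poissonPi (countRate lam) := by
  rw [lintegral_countable', riskKL3]
  simp_rw [← ofReal_jointPmf3 hlam, ← ENNReal.ofReal_mul' (jointPmf3_nonneg hlam _ _ _)]
  rw [← (splitCounts m n).symm.tsum_eq, ENNReal.tsum_prod', ENNReal.tsum_prod']
  rfl

lemma lossKL_nonneg {d lam : (i : Fin m) → Fin (n i) → ℝ} (hd : ∀ i j, 0 < d i j)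
    (hlam : ∀ i j, 0 < lam i j) : 0 ≤ lossKL m n d lam := by
  refine Finset.sum_nonneg fun i _ => Finset.sum_nonneg fun j _ => ?_
  have h := Real.log_le_sub_one_of_pos (div_pos (hd i j) (hlam i j))
  have h2 := mul_le_mul_of_nonneg_left h (hlam i j).le
  have h3 : lam i j * (d i j / lam i j - 1) = d i j - lam i j := by
    have := (hlam i j).ne'
    field_simp
  linarith

end Transfer

section LogRatio

lemma log_add_sub_log_add_nonneg {p q x : ℝ} (hq : 0 < q) (hqp : q ≤ p) (hx : 0 ≤ x) :
    0 ≤ Real.log (x + p) - Real.log (x + q) :=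
  sub_nonneg.2 (Real.log_le_log (by linarith) (by linarith))

lemma log_add_sub_log_add_le {p q x : ℝ} (hq : 0 < q) (hqp : q ≤ p) (hx : 0 ≤ x) :
    Real.log (x + p) - Real.log (x + q) ≤ (p - q) * (x + q)⁻¹ := by
  have h1 : 0 < x + q := by linarith
  have h2 : 0 < x + p := by linarith
  have h := Real.log_le_sub_one_of_pos (div_pos h2 h1)
  rw [Real.log_div h2.ne' h1.ne'] at h
  refine h.trans (le_of_eq ?_)
  field_simp; ring

lemma log_add_sub_log_add_le_const {p q x : ℝ} (hq : 0 < q) (hqp : q ≤ p) (hx : 0 ≤ x) :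
    Real.log (x + p) - Real.log (x + q) ≤ (p - q) * q⁻¹ :=
  (log_add_sub_log_add_le hq hqp hx).trans <|
    mul_le_mul_of_nonneg_left (inv_anti₀ hq (by linarith)) (by linarith)

variable {ι κ : Type*} [Fintype ι] [Fintype κ] (θ : ι → ℝ≥0)

lemma integral_log_ratio_le {e : κ → ι} (he : Function.Injective e) {p q : ℝ} (hq : 1 < q)
    (hqp : q ≤ p) :
    ∫ ω, (Real.log (partialCount e ω + p) - Real.log (partialCount e ω + q)) ∂poissonPi θ ≤
      (p - q) * (∑ k, (θ (e k) : ℝ) + q - 1)⁻¹ := by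
  have hq0 : 0 < q := by linarith
  refine (integral_mono (g := fun ω => (p - q) * (partialCount e ω + q)⁻¹)
    ((integrable_log_partialCount_add θ he (by linarith)).sub
      (integrable_log_partialCount_add θ he hq0))
    (Integrable.const_mul (integrable_of_bound_poissonPi θ (B := q⁻¹) fun ω => ?_) _)
    fun ω => log_add_sub_log_add_le hq0 hqp (partialCount_nonneg e ω)).trans ?_
  · have h0 := partialCount_nonneg e ω
    rw [abs_of_nonneg (by positivity)]
    exact inv_anti₀ hq0 (by linarith)
  · rw [integral_const_mul]
    exact mul_le_mul_of_nonneg_left (integral_inv_partialCount_add_le θ he hq) (by linarith)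

end LogRatio

lemma integral_const_sub_sub_add {Ω : Type*} [MeasurableSpace Ω] {μ : Measure Ω}
    [IsProbabilityMeasure μ] (c : ℝ) {f g h : Ω → ℝ} (hf : Integrable f μ) (hg : Integrable g μ)
    (hh : Integrable h μ) :
    ∫ ω, (c - f ω - g ω + h ω) ∂μ = c - ∫ ω, f ω ∂μ - ∫ ω, g ω ∂μ + ∫ ω, h ω ∂μ := by
  have h1 : Integrable (fun ω => c - f ω) μ := (integrable_const c).sub hf
  have h2 : Integrable (fun ω => c - f ω - g ω) μ := h1.sub hg
  rw [integral_add h2 hh, integral_sub h1 hg, integral_sub (integrable_const c) hf]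
  simp

section Balanced

variable {m nn : ℕ}

/-- The index of `X i j`, as a one-element family. -/
def idxCell (i : Fin m) (j : Fin nn) : Unit → CountIdx m fun _ => nn :=
  fun _ => .inl (.inl ⟨i, j⟩)

/-- The indices of `X i j` for a fixed `i`. -/
def idxRow (i : Fin m) : Fin nn → CountIdx m fun _ => nn := fun j => .inl (.inl ⟨i, j⟩)

/-- The indices of `Y i` and of `X i j` for a fixed `i`. -/
def idxGroup (i : Fin m) : Fin nn ⊕ Unit → CountIdx m fun _ => nn :=
  Sum.elim (fun j => .inl (.inl ⟨i, j⟩)) fun _ => .inl (.inr i)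

/-- The indices of all `X i j` and `Y i`. -/
def idxXY : (Σ _ : Fin m, Fin nn) ⊕ Fin m → CountIdx m fun _ => nn := Sum.inl

lemma idxCell_injective (i : Fin m) (j : Fin nn) : Function.Injective (idxCell i j) :=
  Function.injective_of_subsingleton _

lemma idxRow_injective (i : Fin m) : Function.Injective (idxRow (nn := nn) i) := by
  intro j k h
  simpa [idxRow] using h

lemma idxGroup_injective (i : Fin m) : Function.Injective (idxGroup (nn := nn) i) := by
  rintro (j | j) (k | k) h <;> simp_all [idxGroup]

lemma idxXY_injective : Function.Injective (idxXY (m := m) (nn := nn)) := Sum.inl_injective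

/-- The stick-breaking estimator as a function of the family of all counts. -/
noncomputable def estCounts (α a : ℝ) (ω : CountIdx m (fun _ => nn) → ℕ) :
    Fin m → Fin nn → ℝ :=
  estAA3 m (fun _ => nn) α (fun _ => a) (fun i j => ω (.inl (.inl ⟨i, j⟩)))
    (fun i => ω (.inl (.inr i))) (ω (.inr ()))

lemma sum_partialCount_idxGroup (ω : CountIdx m (fun _ => nn) → ℕ) :
    ∑ i, partialCount (idxGroup i) ω = partialCount idxXY ω := by
  simp [partialCount, idxGroup, idxXY, Fintype.sum_sum_type, Fintype.sum_sigma,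
    Finset.sum_add_distrib]

lemma sum_partialCount_idxCell (ω : CountIdx m (fun _ => nn) → ℕ) (i : Fin m) :
    ∑ j, partialCount (idxCell i j) ω = partialCount (idxRow i) ω := by
  simp [partialCount, idxCell, idxRow]

lemma estCounts_eq (α a : ℝ) (ω : CountIdx m (fun _ => nn) → ℕ) (i : Fin m) (j : Fin nn) :
    estCounts α a ω i j = (partialCount id ω + α) / 3 *
      ((partialCount (idxGroup i) ω + a) / (partialCount idxXY ω + m * a)) *
      ((partialCount (idxCell i j) ω + 1 / 2) / (partialCount (idxRow i) ω + nn / 2)) := by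
  simp [estCounts, estAA3, partialCount, idxGroup, idxXY, idxCell, idxRow,
    Fintype.sum_sum_type, Fintype.sum_sigma]

variable {α a : ℝ}

lemma estCounts_pos (hm : 1 ≤ m) (hnn : 0 < nn) (hα : 0 < α) (ha : 0 < a)
    (ω : CountIdx m (fun _ => nn) → ℕ) (i : Fin m) (j : Fin nn) : 0 < estCounts α a ω i j := by
  have h1 := partialCount_nonneg id ω
  have h2 := partialCount_nonneg (idxGroup i) ω
  have h3 := partialCount_nonneg idxXY ω
  have h4 := partialCount_nonneg (idxCell i j) ω
  have h5 := partialCount_nonneg (idxRow i) ω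
  have h6 : (0 : ℝ) < m := by exact_mod_cast hm
  have h7 : (0 : ℝ) < nn := by exact_mod_cast hnn
  rw [estCounts_eq]
  positivity

lemma log_estCounts (hm : 1 ≤ m) (hnn : 0 < nn) (hα : 0 < α) (ha : 0 < a)
    (ω : CountIdx m (fun _ => nn) → ℕ) (i : Fin m) (j : Fin nn) :
    Real.log (estCounts α a ω i j) = Real.log (partialCount id ω + α) - Real.log 3 +
      (Real.log (partialCount (idxGroup i) ω + a) - Real.log (partialCount idxXY ω + m * a)) +
      (Real.log (partialCount (idxCell i j) ω + 1 / 2) -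
        Real.log (partialCount (idxRow i) ω + nn / 2)) := by
  have h1 := partialCount_nonneg id ω
  have h2 := partialCount_nonneg (idxGroup i) ω
  have h3 := partialCount_nonneg idxXY ω
  have h4 := partialCount_nonneg (idxCell i j) ω
  have h5 := partialCount_nonneg (idxRow i) ω
  have h6 : (0 : ℝ) < m := by exact_mod_cast hm
  have h7 : (0 : ℝ) < nn := by exact_mod_cast hnn
  rw [estCounts_eq, Real.log_mul (by positivity) (by positivity),
    Real.log_mul (by positivity) (by positivity), Real.log_div (by positivity) (by positivity),
    Real.log_div (by positivity) (by positivity), Real.log_div (by positivity) (by positivity)]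

lemma sum_estCounts (hm : 1 ≤ m) (hnn : 0 < nn) (ha : 0 < a)
    (ω : CountIdx m (fun _ => nn) → ℕ) :
    ∑ i, ∑ j, estCounts α a ω i j = (partialCount id ω + α) / 3 := by
  have h3 := partialCount_nonneg idxXY ω
  have h6 : (0 : ℝ) < m := by exact_mod_cast hm
  have h7 : (0 : ℝ) < nn := by exact_mod_cast hnn
  have hrow : ∀ i, ∑ j, (partialCount (idxCell i j) ω + 1 / 2) /
      (partialCount (idxRow i) ω + nn / 2) = 1 := fun i => by
    have h5 := partialCount_nonneg (idxRow i) ω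
    rw [← Finset.sum_div, Finset.sum_add_distrib, sum_partialCount_idxCell]
    simp only [Finset.sum_const, Finset.card_univ, Fintype.card_fin, nsmul_eq_mul]
    rw [mul_one_div]
    exact div_self (by positivity)
  simp_rw [estCounts_eq, ← Finset.mul_sum, hrow, mul_one, ← Finset.mul_sum]
  rw [← Finset.sum_div, Finset.sum_add_distrib, sum_partialCount_idxGroup]
  simp only [Finset.sum_const, Finset.card_univ, Fintype.card_fin, nsmul_eq_mul]
  rw [div_self (by positivity), mul_one]

variable {lam : Fin m → Fin nn → ℝ}

lemma lossKL_estCounts (hm : 1 ≤ m) (hnn : 0 < nn) (hα : 0 < α) (ha : 0 < a)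
    (hlam : ∀ i j, 0 < lam i j) (ω : CountIdx m (fun _ => nn) → ℕ) :
    lossKL m (fun _ => nn) (estCounts α a ω) lam = (partialCount id ω + α) / 3 -
      ∑ i, ∑ j, lam i j * (1 - Real.log (lam i j) +
        (Real.log (partialCount id ω + α) - Real.log 3 +
        (Real.log (partialCount (idxGroup i) ω + a) - Real.log (partialCount idxXY ω + m * a)) +
        (Real.log (partialCount (idxCell i j) ω + 1 / 2) -
          Real.log (partialCount (idxRow i) ω + nn / 2)))) := by
  rw [← sum_estCounts hm hnn ha ω, lossKL]
  simp_rw [← Finset.sum_sub_distrib]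
  refine Finset.sum_congr rfl fun i _ => Finset.sum_congr rfl fun j _ => ?_
  rw [Real.log_div (estCounts_pos hm hnn hα ha ω i j).ne' (hlam i j).ne',
    log_estCounts hm hnn hα ha]
  ring

lemma integrable_lossKL_estCounts (hm : 1 ≤ m) (hnn : 0 < nn) (hα : 0 < α) (ha : 0 < a)
    (hlam : ∀ i j, 0 < lam i j) (θ : CountIdx m (fun _ => nn) → ℝ≥0) :
    Integrable (fun ω => lossKL m (fun _ => nn) (estCounts α a ω) lam) (poissonPi θ) := by
  have h6 : (0 : ℝ) < m := by exact_mod_cast hm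
  have h7 : (0 : ℝ) < nn := by exact_mod_cast hnn
  simp_rw [lossKL_estCounts hm hnn hα ha hlam]
  refine Integrable.sub (((integrable_partialCount θ Function.injective_id).add
    (integrable_const α)).div_const 3) (integrable_finsetSum _ fun i _ =>
    integrable_finsetSum _ fun j _ => Integrable.const_mul ((integrable_const _).add ?_) _)
  exact (((integrable_log_partialCount_add θ Function.injective_id hα).sub
    (integrable_const _)).add
    ((integrable_log_partialCount_add θ (idxGroup_injective i) ha).sub
      (integrable_log_partialCount_add θ idxXY_injective (by positivity)))).add
    ((integrable_log_partialCount_add θ (idxCell_injective i j) (by norm_num)).sub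
      (integrable_log_partialCount_add θ (idxRow_injective i) (by positivity)))

lemma lossKL_estCounts_sub (hm : 1 ≤ m) (hnn : 0 < nn) {β b : ℝ} (hα : 0 < α) (ha : 0 < a)
    (hβ : 0 < β) (hb : 0 < b) (hlam : ∀ i j, 0 < lam i j)
    (ω : CountIdx m (fun _ => nn) → ℕ) :
    lossKL m (fun _ => nn) (estCounts β b ω) lam -
      lossKL m (fun _ => nn) (estCounts α a ω) lam =
    (β - α) / 3 -
      (∑ i, ∑ j, lam i j) *
        (Real.log (partialCount id ω + β) - Real.log (partialCount id ω + α)) -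
      ∑ i, (∑ j, lam i j) *
        (Real.log (partialCount (idxGroup i) ω + b) -
          Real.log (partialCount (idxGroup i) ω + a)) +
      (∑ i, ∑ j, lam i j) *
        (Real.log (partialCount idxXY ω + m * b) -
          Real.log (partialCount idxXY ω + m * a)) := by
  rw [lossKL_estCounts hm hnn hα ha hlam, lossKL_estCounts hm hnn hβ hb hlam]
  simp only [Finset.sum_mul, mul_add, mul_sub, Finset.sum_add_distrib, Finset.sum_sub_distrib]
  ring

lemma sum_countRate_id (hlam : ∀ i j, 0 < lam i j) :
    ∑ k, (countRate (n := fun _ => nn) lam (id k) : ℝ) = 3 * ∑ i, ∑ j, lam i j := by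
  have h1 : ∀ i, 0 ≤ ∑ j, lam i j := fun i => Finset.sum_nonneg fun j _ => (hlam i j).le
  have h2 : 0 ≤ ∑ i, ∑ j, lam i j := Finset.sum_nonneg fun i _ => h1 i
  simp [countRate, Fintype.sum_sum_type, Fintype.sum_sigma, h1, h2, (hlam _ _).le]
  ring

lemma sum_countRate_idxXY (hlam : ∀ i j, 0 < lam i j) :
    ∑ k, (countRate (n := fun _ => nn) lam (idxXY k) : ℝ) = 2 * ∑ i, ∑ j, lam i j := by
  have h1 : ∀ i, 0 ≤ ∑ j, lam i j := fun i => Finset.sum_nonneg fun j _ => (hlam i j).le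
  simp [countRate, idxXY, Fintype.sum_sum_type, Fintype.sum_sigma, h1, (hlam _ _).le]
  ring

lemma sum_countRate_idxGroup (hlam : ∀ i j, 0 < lam i j) (i : Fin m) :
    ∑ k, (countRate (n := fun _ => nn) lam (idxGroup i k) : ℝ) = 2 * ∑ j, lam i j := by
  have h1 : ∀ i, 0 ≤ ∑ j, lam i j := fun i => Finset.sum_nonneg fun j _ => (hlam i j).le
  simp [countRate, idxGroup, Fintype.sum_sum_type, h1, (hlam _ _).le]
  ring

/-- The gap between the group-level and the top-level log ratios, in expectation. -/
lemma sum_integral_log_ratio_sub_le (hm : 1 ≤ m) {b : ℝ} (ha : (m : ℝ) + 1 ≤ m * a)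
    (hab : a ≤ b) (hlam : ∀ i j, 0 < lam i j) :
    (∑ i, (2 * ∑ j, lam i j) * ∫ ω, (Real.log (partialCount (idxGroup i) ω + b) -
        Real.log (partialCount (idxGroup i) ω + a))
          ∂poissonPi (countRate (n := fun _ => nn) lam)) -
      (2 * ∑ i, ∑ j, lam i j) * ∫ ω, (Real.log (partialCount idxXY ω + m * b) -
        Real.log (partialCount idxXY ω + m * a))
          ∂poissonPi (countRate (n := fun _ => nn) lam) ≤
    (m - 1) * (m * b - m * a) * (2 * (∑ i, ∑ j, lam i j) + m * b - 1)⁻¹ := by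
  have hm1 : (1 : ℝ) ≤ m := by exact_mod_cast hm
  have ha0 : 0 < a := by nlinarith
  have hA0 : 0 < m * a := by linarith
  have hAB : m * a ≤ m * b := by gcongr
  set P := poissonPi (countRate (n := fun _ => nn) lam)
  have hV := fun i : Fin m => integral_partialCount_mul (countRate (n := fun _ => nn) lam)
    (idxGroup_injective i) (f := fun x => Real.log (x + b) - Real.log (x + a))
    fun x hx => log_add_sub_log_add_nonneg ha0 hab hx
  have hVi := fun i : Fin m => integrable_partialCount_mul (countRate (n := fun _ => nn) lam)
    (idxGroup_injective i) (f := fun x => Real.log (x + b) - Real.log (x + a))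
    (fun x hx => log_add_sub_log_add_nonneg ha0 hab hx)
    fun x hx => log_add_sub_log_add_le_const ha0 hab hx
  have hS := integral_partialCount_mul (countRate (n := fun _ => nn) lam)
    idxXY_injective (f := fun x => Real.log (x + m * b) - Real.log (x + m * a))
    fun x hx => log_add_sub_log_add_nonneg hA0 hAB hx
  have hSi := integrable_partialCount_mul (countRate (n := fun _ => nn) lam)
    idxXY_injective (f := fun x => Real.log (x + m * b) - Real.log (x + m * a))
    (fun x hx => log_add_sub_log_add_nonneg hA0 hAB hx)
    fun x hx => log_add_sub_log_add_le_const hA0 hAB hx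
  simp only [sum_countRate_idxGroup hlam] at hV
  rw [sum_countRate_idxXY hlam] at hS
  rw [← hS, ← Finset.sum_congr rfl fun i _ => hV i, ← integral_finsetSum _ fun i _ => hVi i,
    ← integral_sub (integrable_finsetSum _ fun i _ => hVi i) hSi]
  have hinv := integral_inv_partialCount_add_le (countRate (n := fun _ => nn) lam)
    idxXY_injective (c := m * b) (by linarith)
  rw [sum_countRate_idxXY hlam] at hinv
  refine le_trans (integral_mono
    (g := fun ω => (m - 1) * (m * b - m * a) * (partialCount idxXY ω + m * b)⁻¹)
    ((integrable_finsetSum _ fun i _ => hVi i).sub hSi)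
    (Integrable.const_mul (integrable_of_bound_poissonPi _ (B := (m * b)⁻¹) fun ω => ?_) _)
    fun ω => ?_) ?_
  · have h0 := partialCount_nonneg idxXY ω
    have hB0 : 0 < m * b := by linarith
    rw [abs_of_nonneg (by positivity)]
    exact inv_anti₀ hB0 (by linarith)
  · have h := sum_mul_log_sub_mul_log_le hm ha hab
      (v := fun i => partialCount (idxGroup i) ω) fun i => partialCount_nonneg _ ω
    rw [sum_partialCount_idxGroup] at h
    exact h
  · rw [integral_const_mul]
    exact mul_le_mul_of_nonneg_left hinv (mul_nonneg (by linarith) (by linarith))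

/-- The stick-breaking estimator has smaller expected entropy loss than the one with parameters
`(N, b)`, `N = m * b`. -/
lemma integral_lossKL_estCounts_lt (hm : 1 ≤ m) (hnn : 0 < nn) {b : ℝ} (hα1 : 1 < α)
    (hα2 : α < m * b) (ha : (m : ℝ) + 1 ≤ m * a) (hab : a < b)
    (hA : (3 / 2 : ℝ) * (m - 1) * (m * b - m * a) ≤ 2 / 3 * (m * b - α) * (α - 1))
    (hlam : ∀ i j, 0 < lam i j) :
    ∫ ω, lossKL m (fun _ => nn) (estCounts α a ω) lam
        ∂poissonPi (countRate (n := fun _ => nn) lam) <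
      ∫ ω, lossKL m (fun _ => nn) (estCounts (m * b) b ω) lam
        ∂poissonPi (countRate (n := fun _ => nn) lam) := by
  have hm1 : (1 : ℝ) ≤ m := by exact_mod_cast hm
  have ha0 : 0 < a := by nlinarith
  have hb0 : 0 < b := by linarith
  have hα0 : 0 < α := by linarith
  have hB0 : 0 < m * b := by linarith
  have hgap := sum_integral_log_ratio_sub_le (nn := nn) hm ha hab.le hlam
  have htop := integral_log_ratio_le (countRate (n := fun _ => nn) lam)
    Function.injective_id hα1 hα2.le
  rw [sum_countRate_id hlam] at htop
  set θ := countRate (n := fun _ => nn) lam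
  have hid {c : ℝ} (hc : 0 < c) :=
    integrable_log_partialCount_add θ Function.injective_id hc
  have hgr (i : Fin m) {c : ℝ} (hc : 0 < c) :=
    integrable_log_partialCount_add θ (idxGroup_injective i) hc
  have hxy {c : ℝ} (hc : 0 < c) := integrable_log_partialCount_add θ idxXY_injective hc
  rw [← sub_pos, ← integral_sub (integrable_lossKL_estCounts hm hnn hB0 hb0 hlam θ)
    (integrable_lossKL_estCounts hm hnn hα0 ha0 hlam θ)]
  simp_rw [lossKL_estCounts_sub hm hnn hα0 ha0 hB0 hb0 hlam]
  have i1 := ((hid hB0).sub (hid hα0)).const_mul (∑ i, ∑ j, lam i j)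
  have i2 := fun i => ((hgr i hb0).sub (hgr i ha0)).const_mul (∑ j, lam i j)
  have i3 := ((hxy hB0).sub (hxy (by linarith : 0 < m * a))).const_mul (∑ i, ∑ j, lam i j)
  simp only [Pi.sub_apply] at i1 i2 i3
  have i2s := integrable_finsetSum Finset.univ fun i _ => i2 i
  rw [integral_const_sub_sub_add _ i1 i2s i3, integral_finsetSum _ fun i _ => i2 i]
  simp only [integral_const_mul]
  simp only [mul_assoc, ← Finset.mul_sum] at hgap
  have hL : 0 ≤ ∑ i, ∑ j, lam i j :=
    Finset.sum_nonneg fun i _ => Finset.sum_nonneg fun j _ => (hlam i j).le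
  set L := ∑ i, ∑ j, lam i j
  have htop' := mul_le_mul_of_nonneg_left htop hL
  have hN : 0 < 2 * L + m * b - 1 := by linarith
  have hW : 0 < 3 * L + α - 1 := by linarith
  have hD : (m - 1) * ((m * b - m * a) * (2 * L + m * b - 1)⁻¹) ≤
      4 / 9 * ((m * b - α) * (α - 1)) * (2 * L + m * b - 1)⁻¹ := by
    rw [← mul_assoc]
    refine mul_le_mul_of_nonneg_right ?_ (inv_nonneg.2 hN.le)
    linarith
  have hkey : 4 / 9 * ((m * b - α) * (α - 1)) * (2 * L + m * b - 1)⁻¹ <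
      2 / 3 * ((m * b - α) * (α - 1)) * (3 * L + α - 1)⁻¹ := by
    rw [← div_eq_mul_inv, ← div_eq_mul_inv, div_lt_div_iff₀ hN hW]
    have : 0 < (m * b - α) * (α - 1) := mul_pos (by linarith) (by linarith)
    nlinarith
  have hW2 : L * ((m * b - α) * (3 * L + α - 1)⁻¹) =
      (m * b - α) / 3 - 1 / 3 * ((m * b - α) * (α - 1)) * (3 * L + α - 1)⁻¹ := by
    linear_combination (m * b - α) / 3 * mul_inv_cancel₀ hW.ne'
  linarith

end Balanced

/- STATEMENT 15: balanced case n_1 = … = n_m > 2 with the extra top-level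
observation Z. If 1 < α < n·/2, (m+1)/m ≤ a_1 = … = a_m < n_1/2,
(2/3)(n·/2 − α)(α − 1) ≥ (3/2)(m − 1)(n·/2 − a·) and
(n·/2 − α)(n·/2 − 1)/3 ≥ (m − 1)(n·/2 − a·)/2, then under the entropy loss
λ̂^{(α;a)}(X,Y,Z) strictly dominates the Jeffreys-prior estimator λ̂^J(X,Y,Z). -/
theorem stmt_15 (m : ℕ) (hm : 1 ≤ m) (n : Fin m → ℕ) (nn : ℕ)
    (hbal : ∀ i, n i = nn) (hnn : 2 < nn)
    (α : ℝ) (a : Fin m → ℝ) (a0 : ℝ) (habal : ∀ i, a i = a0)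
    (hα1 : 1 < α) (hα2 : α < (∑ i, (n i : ℝ)) / 2)
    (ha1 : ((m : ℝ) + 1) / m ≤ a0) (ha2 : a0 < (nn : ℝ) / 2)
    (hA1 : (3 / 2 : ℝ) * ((m : ℝ) - 1) * ((∑ i, (n i : ℝ)) / 2 - ∑ i, a i) ≤
      2 / 3 * ((∑ i, (n i : ℝ)) / 2 - α) * (α - 1))
    (hA2 : ((m : ℝ) - 1) * ((∑ i, (n i : ℝ)) / 2 - ∑ i, a i) / 2 ≤
      ((∑ i, (n i : ℝ)) / 2 - α) * ((∑ i, (n i : ℝ)) / 2 - 1) / 3)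
    (lam : (i : Fin m) → Fin (n i) → ℝ) (hlam : ∀ i j, 0 < lam i j) :
    riskKL3 m n (estAA3 m n α a) lam <
      riskKL3 m n (estAA3 m n ((∑ i, (n i : ℝ)) / 2) (fun i => (n i : ℝ) / 2)) lam := by
  obtain rfl : n = fun _ => nn := funext hbal
  obtain rfl : a = fun _ => a0 := funext habal
  have hm0 : (0 : ℝ) < m := by exact_mod_cast hm
  have hnn0 : 0 < nn := by omega
  have hN : (∑ _i : Fin m, (nn : ℝ)) / 2 = m * ((nn : ℝ) / 2) := by
    simp [mul_div_assoc]
  have hA : ∑ _i : Fin m, a0 = m * a0 := by simp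
  simp only [hN, hA] at hα2 hA1 ⊢
  rw [div_le_iff₀ hm0, mul_comm] at ha1
  have ha0 : 0 < a0 := by nlinarith
  have hb0 : (0 : ℝ) < (nn : ℝ) / 2 := by linarith
  have hlt := integral_lossKL_estCounts_lt hm hnn0 hα1 hα2 ha1 ha2 hA1 hlam
  have hrisk : ∀ {β b : ℝ}, 0 < β → 0 < b →
      riskKL3 m (fun _ => nn) (estAA3 m (fun _ => nn) β fun _ => b) lam =
        ENNReal.ofReal (∫ ω, lossKL m (fun _ => nn) (estCounts β b ω) lam
          ∂poissonPi (countRate (n := fun _ => nn) lam)) := fun {β b} hβ hb => by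
    rw [riskKL3_eq_lintegral fun i j => (hlam i j).le, ofReal_integral_eq_lintegral_ofReal
      (integrable_lossKL_estCounts hm hnn0 hβ hb hlam _)
      (.of_forall fun ω => lossKL_nonneg (estCounts_pos hm hnn0 hβ hb ω) hlam)]
    rfl
  rw [hrisk (by linarith) ha0, hrisk (by linarith) hb0]
  refine (ENNReal.ofReal_lt_ofReal_iff (lt_of_le_of_lt (integral_nonneg fun ω => ?_) hlt)).2 hlt
  exact lossKL_nonneg (estCounts_pos hm hnn0 (by linarith) ha0 ω) hlam
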